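/- For all natural numbers n₀ and k ≥ 1, the following identity of formal power series in z and q holds: ∑_{n₀ ≥ n₁ ≥ n₂ ≥ ⋯ ≥ n_k ≥ 0} z^{n₁+⋯+n_k} q^{n₁²+⋯+n_k²} [n₀ choose n₁]_q [n₁ choose n₂]_q ⋯ [n_{k−1} choose n_k]_q / (zq;q)_{n_k} = 1/(zq;q)_{n₀}, where the sum is over all weakly decreasing chains n₀ ≥ n₁ ≥ ⋯ ≥ n_k ≥ 0 of natural numbers. -/

import Mathlib

noncomputable section

/-- The ring of formal power series `ℚ[[z,q]]`. -/
abbrev R2 : Type := MvPowerSeries (Fin 2) ℚ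

/-- The variable `z`. -/
def Z : R2 := MvPowerSeries.X 0
/-- The variable `q`. -/
def Q : R2 := MvPowerSeries.X 1

/-- The q-Pochhammer symbol `(a;q)_n = ∏_{t=0}^{n-1} (1 - a q^t)`. -/
def poch (a : R2) (n : ℕ) : R2 := ∏ t ∈ Finset.range n, (1 - a * Q ^ t)

/-- `(q;q)_n`. -/
def qp (n : ℕ) : R2 := poch Q n

/-- The Gaussian binomial coefficient `[n choose k]_q = (q;q)_n / ((q;q)_k (q;q)_{n-k})`
for `0 ≤ k ≤ n`, and `0` otherwise. -/
def gbinom (n k : ℕ) : R2 := if k ≤ n then qp n * (qp k * qp (n - k))⁻¹ else 0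

theorem poch_zero (a : R2) : poch a 0 = 1 := by simp [poch]

theorem poch_succ (a : R2) (n : ℕ) : poch a (n + 1) = poch a n * (1 - a * Q ^ n) := by
  simp [poch, Finset.prod_range_succ]

theorem poch_add (a : R2) (m n : ℕ) : poch a (m + n) = poch a m * poch (a * Q ^ m) n := by
  simp [poch, Finset.prod_range_add, pow_add, mul_assoc]

theorem constantCoeff_poch_mul_Q (a : R2) (n : ℕ) :
    MvPowerSeries.constantCoeff (poch (a * Q) n) = 1 := by
  simp [poch, Q, map_prod]

theorem constantCoeff_qp (n : ℕ) : MvPowerSeries.constantCoeff (qp n) = 1 := by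
  simpa [qp] using constantCoeff_poch_mul_Q 1 n

theorem qp_ne_zero (n : ℕ) : qp n ≠ 0 := by
  intro h
  simpa [h] using constantCoeff_qp n

theorem qp_succ (n : ℕ) : qp (n + 1) = qp n * (1 - Q ^ (n + 1)) := by
  rw [qp, poch_succ, ← pow_succ', qp]

theorem gbinom_add_mul (m d : ℕ) : gbinom (m + d) m * (qp m * qp d) = qp (m + d) := by
  rw [gbinom, if_pos (Nat.le_add_right m d), Nat.add_sub_cancel_left, mul_assoc,
    MvPowerSeries.inv_mul_cancel, mul_one]
  simp [constantCoeff_qp]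

theorem gbinom_of_lt {n k : ℕ} (h : n < k) : gbinom n k = 0 := if_neg (by omega)

theorem gbinom_zero_right (n : ℕ) : gbinom n 0 = 1 := by
  have h := gbinom_add_mul 0 n
  rw [zero_add, show qp 0 = 1 from poch_zero Q, one_mul] at h
  exact mul_right_cancel₀ (qp_ne_zero n) (h.trans (one_mul _).symm)

theorem gbinom_self (n : ℕ) : gbinom n n = 1 := by
  have h := gbinom_add_mul n 0
  rw [add_zero, show qp 0 = 1 from poch_zero Q, mul_one] at h
  exact mul_right_cancel₀ (qp_ne_zero n) (h.trans (one_mul _).symm)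

/-- The q-Pascal rule. -/
theorem gbinom_succ_succ {n m : ℕ} (hm : m ≤ n) :
    gbinom (n + 1) (m + 1) = gbinom n (m + 1) + Q ^ (n - m) * gbinom n m := by
  obtain ⟨d, rfl⟩ := Nat.exists_eq_add_of_le hm
  rw [Nat.add_sub_cancel_left]
  cases d with
  | zero => simp [gbinom_self, gbinom_of_lt]
  | succ d =>
    have h₁ := gbinom_add_mul (m + 1) (d + 1)
    have h₂ := gbinom_add_mul (m + 1) d
    have h₃ := gbinom_add_mul m (d + 1)
    rw [show m + 1 + (d + 1) = m + (d + 1) + 1 by ring, qp_succ (m + (d + 1))] at h₁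
    rw [show m + 1 + d = m + (d + 1) by ring] at h₂
    refine mul_right_cancel₀ (mul_ne_zero (qp_ne_zero (m + 1)) (qp_ne_zero (d + 1))) ?_
    rw [h₁]
    rw [qp_succ m, qp_succ d] at *
    linear_combination (-(1 - Q ^ (d + 1))) * h₂ - Q ^ (d + 1) * (1 - Q ^ (m + 1)) * h₃

/-- A finite form of the Durfee square identity. -/
theorem sum_gbinom_mul_poch (n : ℕ) (a : R2) :
    ∑ m ∈ Finset.range (n + 1),
      a ^ m * Q ^ (m ^ 2) * gbinom n m * poch (a * Q ^ (m + 1)) (n - m) = 1 := by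
  induction n generalizing a with
  | zero => simp [gbinom_zero_right, poch_zero]
  | succ n ih =>
    have hpoch : ∀ m ∈ Finset.range (n + 1), poch (a * Q ^ (m + 1)) (n + 1 - m) =
        poch (a * Q ^ (m + 1)) (n - m) * (1 - a * Q ^ (n + 1)) := by
      intro m hm
      have hm : m ≤ n := Nat.lt_succ_iff.mp (Finset.mem_range.mp hm)
      rw [Nat.succ_sub hm, poch_succ, mul_assoc a, ← pow_add,
        show m + 1 + (n - m) = n + 1 by omega]
    have hfirst : ∑ m ∈ Finset.range (n + 2),
        a ^ m * Q ^ (m ^ 2) * gbinom n m * poch (a * Q ^ (m + 1)) (n + 1 - m) =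
        1 - a * Q ^ (n + 1) := by
      rw [Finset.sum_range_succ, gbinom_of_lt (Nat.lt_succ_self n), mul_zero, zero_mul, add_zero,
        Finset.sum_congr rfl fun m hm => by rw [hpoch m hm, ← mul_assoc],
        ← Finset.sum_mul, ih a, one_mul]
    have hsecond : ∑ m ∈ Finset.range (n + 1), a ^ (m + 1) * Q ^ ((m + 1) ^ 2) *
        (Q ^ (n - m) * gbinom n m) * poch (a * Q ^ (m + 1 + 1)) (n + 1 - (m + 1)) =
        a * Q ^ (n + 1) := by
      rw [← mul_one (a * Q ^ (n + 1)), ← ih (a * Q), Finset.mul_sum]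
      refine Finset.sum_congr rfl fun m hm => ?_
      obtain ⟨d, rfl⟩ := Nat.exists_eq_add_of_le (Nat.lt_succ_iff.mp (Finset.mem_range.mp hm))
      rw [show m + d + 1 - (m + 1) = d by omega, show m + d - m = d by omega,
        show a * Q * Q ^ (m + 1) = a * Q ^ (m + 1 + 1) by ring]
      ring
    rw [Finset.sum_range_succ']
    rw [Finset.sum_range_succ'] at hfirst
    rw [Finset.sum_congr rfl fun m hm => by
      rw [gbinom_succ_succ (Nat.lt_succ_iff.mp (Finset.mem_range.mp hm)), mul_add, add_mul],
      Finset.sum_add_distrib, hsecond]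
    simp only [gbinom_zero_right] at hfirst ⊢
    linear_combination hfirst

theorem sum_gbinom_mul_poch_inv (n : ℕ) :
    ∑ m ∈ Finset.range (n + 1), Z ^ m * Q ^ (m ^ 2) * gbinom n m * (poch (Z * Q) m)⁻¹ =
      (poch (Z * Q) n)⁻¹ := by
  have hinv (m : ℕ) : poch (Z * Q) m * (poch (Z * Q) m)⁻¹ = 1 :=
    MvPowerSeries.mul_inv_cancel _ (by simp [constantCoeff_poch_mul_Q])
  rw [← one_mul (poch (Z * Q) n)⁻¹, ← sum_gbinom_mul_poch n Z, Finset.sum_mul]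
  refine Finset.sum_congr rfl fun m hm => ?_
  obtain ⟨d, rfl⟩ := Nat.exists_eq_add_of_le (Nat.lt_succ_iff.mp (Finset.mem_range.mp hm))
  have hsplit := poch_add (Z * Q) m d
  rw [mul_assoc Z, ← pow_succ'] at hsplit
  have hd := hinv (m + d)
  rw [hsplit] at hd ⊢
  rw [Nat.add_sub_cancel_left]
  linear_combination (-(Z ^ m * Q ^ (m ^ 2) * gbinom (m + d) m * (poch (Z * Q) m)⁻¹)) * hd +
    Z ^ m * Q ^ (m ^ 2) * gbinom (m + d) m * poch (Z * Q ^ (m + 1)) d *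
      (poch (Z * Q) m * poch (Z * Q ^ (m + 1)) d)⁻¹ * hinv m

/-- The summand attached to a tuple `g = (n₀, …, n_k)`; it vanishes unless `g` is weakly
decreasing. -/
def chainTerm {k : ℕ} (g : Fin (k + 1) → ℕ) : R2 :=
  if ∀ i : Fin k, g i.succ ≤ g i.castSucc then
    Z ^ (∑ i : Fin k, g i.succ) * Q ^ (∑ i : Fin k, (g i.succ) ^ 2) *
      (∏ i : Fin k, gbinom (g i.castSucc) (g i.succ)) *
      (poch (Z * Q) (g (Fin.last k)))⁻¹
  else 0

theorem chainTerm_cons {k : ℕ} (n : ℕ) (g : Fin (k + 1) → ℕ) :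
    chainTerm (Fin.cons n g : Fin (k + 2) → ℕ) =
      Z ^ g 0 * Q ^ (g 0 ^ 2) * gbinom n (g 0) * chainTerm g := by
  by_cases h₀ : g 0 ≤ n
  · by_cases h : ∀ i : Fin k, g i.succ ≤ g i.castSucc
    · have h' : ∀ i : Fin (k + 1), (Fin.cons n g : Fin (k + 2) → ℕ) i.succ ≤
          (Fin.cons n g : Fin (k + 2) → ℕ) i.castSucc := by
        simpa [Fin.forall_fin_succ, ← Fin.succ_castSucc, h₀] using h
      rw [chainTerm, if_pos h', chainTerm, if_pos h]
      simp only [Fin.cons_succ, Fin.sum_univ_succ, Fin.prod_univ_succ, Fin.castSucc_zero,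
        Fin.cons_zero, ← Fin.succ_castSucc, ← Fin.succ_last, pow_add]
      ring
    · have h' : ¬ ∀ i : Fin (k + 1), (Fin.cons n g : Fin (k + 2) → ℕ) i.succ ≤
          (Fin.cons n g : Fin (k + 2) → ℕ) i.castSucc := fun H =>
        h fun i => by simpa [← Fin.succ_castSucc] using H i.succ
      rw [chainTerm, if_neg h', chainTerm, if_neg h, mul_zero]
  · have h' : ¬ ∀ i : Fin (k + 1), (Fin.cons n g : Fin (k + 2) → ℕ) i.succ ≤
        (Fin.cons n g : Fin (k + 2) → ℕ) i.castSucc := fun H => h₀ (by simpa using H 0)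
    rw [chainTerm, if_neg h', gbinom_of_lt (not_le.mp h₀), mul_zero, zero_mul]

theorem sum_chainTerm (N k : ℕ) {n : ℕ} (hn : n ≤ N) :
    ∑ f : Fin k → Fin (N + 1), chainTerm (Fin.cons n (fun j => (f j : ℕ)) : Fin (k + 1) → ℕ) =
      (poch (Z * Q) n)⁻¹ := by
  induction k generalizing n with
  | zero => simp [chainTerm]
  | succ k ih =>
    rw [← (Fin.consEquiv fun _ : Fin (k + 1) => Fin (N + 1)).sum_comp, Fintype.sum_prod_type]
    have hcons (m : Fin (N + 1)) (f : Fin k → Fin (N + 1)) :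
        (fun j => (((Fin.consEquiv fun _ : Fin (k + 1) => Fin (N + 1)) (m, f) j : Fin (N + 1)) : ℕ))
          = (Fin.cons (m : ℕ) (fun j => (f j : ℕ)) : Fin (k + 1) → ℕ) := by
      funext j
      refine Fin.cases ?_ (fun i => ?_) j <;> simp [Fin.consEquiv]
    simp only [hcons, chainTerm_cons, Fin.cons_zero, ← Finset.mul_sum]
    rw [Finset.sum_congr rfl fun m _ => by rw [ih (Nat.lt_succ_iff.mp m.isLt)],
      Fin.sum_univ_eq_sum_range
        (fun m => Z ^ m * Q ^ (m ^ 2) * gbinom n m * (poch (Z * Q) m)⁻¹) (N + 1),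
      ← sum_gbinom_mul_poch_inv n]
    refine (Finset.sum_subset (Finset.range_mono (by omega)) fun m _ hm => ?_).symm
    rw [gbinom_of_lt (by simpa using hm), mul_zero, zero_mul]

/-- Identity `eqn:andrewswarnaar`: for `n₀ ∈ ℕ` and `k ≥ 1`,
`∑_{n₀ ≥ n₁ ≥ ⋯ ≥ n_k ≥ 0} z^{n₁+⋯+n_k} q^{n₁²+⋯+n_k²}
  [n₀ choose n₁]_q ⋯ [n_{k−1} choose n_k]_q / (zq;q)_{n_k} = 1/(zq;q)_{n₀}`.
The sum is encoded as a sum over all tuples `(n₁,…,n_k)` with entries `≤ n₀`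
(which is no restriction in the presence of the chain condition `n₀ ≥ n₁ ≥ ⋯ ≥ n_k`;
tuples violating the chain condition contribute `0`). -/
theorem statement2 (n₀ k : ℕ) (hk : 1 ≤ k) :
    (∑ f : Fin k → Fin (n₀ + 1),
      (fun g : Fin (k + 1) → ℕ =>
        if ∀ i : Fin k, g i.succ ≤ g i.castSucc then
          Z ^ (∑ i : Fin k, g i.succ) * Q ^ (∑ i : Fin k, (g i.succ) ^ 2) *
            (∏ i : Fin k, gbinom (g i.castSucc) (g i.succ)) *
            (poch (Z * Q) (g (Fin.last k)))⁻¹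
        else 0)
      (Fin.cons n₀ (fun j => (f j : ℕ))))
      = (poch (Z * Q) n₀)⁻¹ := by
  exact sum_chainTerm n₀ k le_rfl
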